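/- Suppose f is a transduction that is invariant under permutations and without data peeking, u1, u2 are data words with u1 ≡_f u2, ifl_f(u1) = d_1^m d_1^{m−1} ⋯ d_1^1 and ifl_f(u2) = d_2^m d_2^{m−1} ⋯ d_2^1, d_1^0 is a data value that is not f-influencing in u1, d_2^0 is a data value that is not f-influencing in u2, and σ ∈ Σ. Then for all j ∈ [0,m]: u1·(σ,d_1^j) ≡_f u2·(σ,d_2^j). -/

import Mathlib

namespace SSRT

/-- Elements of a factored output: either a retained output triple
(letter, data value, origin — integer origins allow shifting by `z`),
or one of the placeholder marks `(*,*,left)`, `(*,*,middle)`, `(*,*,right)`. -/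
inductive FOElem (G D : Type) where
  | tri (g : G) (d : D) (o : ℤ)
  | left
  | middle
  | right
  deriving DecidableEq

namespace FOElem

def isTri {G D : Type} : FOElem G D → Bool
  | .tri _ _ _ => true
  | _ => false

def isMark {G D : Type} (e : FOElem G D) : Bool := !e.isTri

end FOElem

/-- Data words over the input alphabet `A` with data from `D`. -/
abbrev DataWord (A D : Type) := List (A × D)

/-- Data words with origin information over the output alphabet `G`;
positions of the input are numbered 1,…,n. -/
abbrev OutWord (G D : Type) := List (G × D × ℕ)

/-- A transduction. -/
abbrev Transduction (A G D : Type) := DataWord A D → OutWord G D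

variable {A G D : Type}

/-- Apply a permutation of data values to a data word. -/
def permW (π : Equiv.Perm D) (u : DataWord A D) : DataWord A D :=
  u.map fun p => (p.1, π p.2)

/-- Apply a permutation of data values to an output word. -/
def permOut (π : Equiv.Perm D) (w : OutWord G D) : OutWord G D :=
  w.map fun t => (t.1, π t.2.1, t.2.2)

/-- Apply a permutation of data values to a factored output
(placeholder marks are unchanged). -/
def permFO (π : Equiv.Perm D) : List (FOElem G D) → List (FOElem G D) :=
  List.map fun e => match e with
    | .tri g d o => .tri g (π d) o
    | .left => .left
    | .middle => .middle
    | .right => .right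

/-- Shift the origin of every retained triple by `z`. -/
def foShift (z : ℤ) : List (FOElem G D) → List (FOElem G D) :=
  List.map fun e => match e with
    | .tri g d o => .tri g d (o + z)
    | .left => .left
    | .middle => .middle
    | .right => .right

/-- `f` is invariant under permutations. -/
def PermInvariant (f : Transduction A G D) : Prop :=
  ∀ (π : Equiv.Perm D) (u : DataWord A D), f (permW π u) = permOut π (f u)

/-- `f` is without data peeking: every data value output from origin `o`
already occurs in the input at some position `≤ o`. -/
def NoDataPeeking (f : Transduction A G D) : Prop :=
  ∀ (w : DataWord A D) (t : G × D × ℕ), t ∈ f w →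
    ∃ (i : ℕ) (a : A), w[i]? = some (a, t.2.1) ∧ i + 1 ≤ t.2.2

/-- `f` has linear blow up. -/
def LinearBlowUp (f : Transduction A G D) : Prop :=
  ∃ K : ℕ, ∀ (w : DataWord A D) (o : ℕ), 1 ≤ o → o ≤ w.length →
    ((f w).filter fun t => t.2.2 == o).length ≤ K

variable [DecidableEq G] [DecidableEq D]

/-- Merge consecutive occurrences of equal placeholder marks into one. -/
def collapse : List (FOElem G D) → List (FOElem G D)
  | [] => []
  | [a] => [a]
  | a :: b :: rest =>
      if a = b ∧ a.isMark then collapse (b :: rest)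
      else a :: collapse (b :: rest)

/-- The factored output `f(u̲ ∣ v)`. -/
def leftFac (f : Transduction A G D) (u v : DataWord A D) : List (FOElem G D) :=
  collapse ((f (u ++ v)).map fun t =>
    if t.2.2 ≤ u.length then FOElem.left else FOElem.tri t.1 t.2.1 (t.2.2 : ℤ))

/-- The factored output `f(u ∣ v̲)`. -/
def rightFac (f : Transduction A G D) (u v : DataWord A D) : List (FOElem G D) :=
  collapse ((f (u ++ v)).map fun t =>
    if u.length < t.2.2 then FOElem.right else FOElem.tri t.1 t.2.1 (t.2.2 : ℤ))

/-- The factored output `f(u̲ ∣ v ∣ w̲)`. -/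
def threeFac (f : Transduction A G D) (u v w : DataWord A D) : List (FOElem G D) :=
  collapse ((f (u ++ v ++ w)).map fun t =>
    if t.2.2 ≤ u.length then FOElem.left
    else if t.2.2 ≤ u.length + v.length then FOElem.tri t.1 t.2.1 (t.2.2 : ℤ)
    else FOElem.right)

/-- The factored output `f(u̲ ∣ v̲ ∣ w̲)`. -/
def allFac (f : Transduction A G D) (u v w : DataWord A D) : List (FOElem G D) :=
  collapse ((f (u ++ v ++ w)).map fun t =>
    if t.2.2 ≤ u.length then FOElem.left
    else if t.2.2 ≤ u.length + v.length then FOElem.middle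
    else FOElem.right)

/-- `u[d/d']`: replace every occurrence of the data value `d` by `d'`. -/
def replaceD (u : DataWord A D) (d d' : D) : DataWord A D :=
  u.map fun p => (p.1, if p.2 = d then d' else p.2)

/-- Isomorphism of data words: same length, same letters, and the same
equalities among the data values at the various positions. -/
def Iso (u u' : DataWord A D) : Prop :=
  u.length = u'.length ∧
  (∀ i : ℕ, u[i]?.map Prod.fst = u'[i]?.map Prod.fst) ∧
  (∀ i j : ℕ, (u[i]?.map Prod.snd = u[j]?.map Prod.snd) ↔
          (u'[i]?.map Prod.snd = u'[j]?.map Prod.snd))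

/-- `d'` is a safe replacement for `d` in `u`. -/
def SafeRepl (d d' : D) (u : DataWord A D) : Prop := Iso (replaceD u d d') u

def OccursIn (d : D) (u : DataWord A D) : Prop := ∃ p ∈ u, p.2 = d

/-- `d` is `f`-memorable in `u`. -/
def Memorable (f : Transduction A G D) (d : D) (u : DataWord A D) : Prop :=
  ∃ (v : DataWord A D) (d' : D), SafeRepl d d' u ∧
    leftFac f (replaceD u d d') v ≠ leftFac f u v

/-- `d` is `f`-vulnerable in `u`. -/
def Vulnerable (f : Transduction A G D) (d : D) (u : DataWord A D) : Prop :=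
  ∃ (u' v : DataWord A D) (d' : D), ¬ OccursIn d u' ∧
    SafeRepl d d' (u ++ u' ++ v) ∧
    rightFac f (u ++ u') (replaceD v d d') ≠ rightFac f (u ++ u') v

/-- `d` is `f`-influencing in `u`. -/
def Influencing (f : Transduction A G D) (d : D) (u : DataWord A D) : Prop :=
  Memorable f d u ∨ Vulnerable f d u

/-- The last occurrence of `d` in `u` is at (0-based) index `i`. -/
def IsLastOcc (u : DataWord A D) (d : D) (i : ℕ) : Prop :=
  (∃ a : A, u[i]? = some (a, d)) ∧ ∀ j : ℕ, i < j → ∀ p : A × D, u[j]? = some p → p.2 ≠ d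

/-- `d` is fresher than `e` in `u`: the last occurrence of `d` in `u` is
strictly to the right of the last occurrence of `e`. -/
def Fresher (u : DataWord A D) (d e : D) : Prop :=
  ∃ i j : ℕ, IsLastOcc u d i ∧ IsLastOcc u e j ∧ j < i

/-- `l` is the sequence of all `f`-influencing values of `u`, listed freshest
first: the `i`-th element (1-based) is the `i`-th `f`-influencing value of `u`.
(The paper writes this sequence in the reverse direction, as `d_m ⋯ d_1`.) -/
def IsIflSeq (f : Transduction A G D) (u : DataWord A D) (l : List D) : Prop :=
  (∀ d, d ∈ l ↔ Influencing f d u) ∧ l.Nodup ∧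
  ∀ (i j : ℕ) (hi : i < l.length) (hj : j < l.length), i < j →
    Fresher u (l.get ⟨i, hi⟩) (l.get ⟨j, hj⟩)

/-- The type annotation of an influencing value. -/
inductive IflType where
  | vm | m | v
  deriving DecidableEq

def HasIflType (f : Transduction A G D) (u : DataWord A D) (d : D) :
    IflType → Prop
  | .vm => Memorable f d u ∧ Vulnerable f d u
  | .m => Memorable f d u ∧ ¬ Vulnerable f d u
  | .v => Vulnerable f d u ∧ ¬ Memorable f d u

/-- `al` is `aifl_f(u)` (listed freshest first). -/
def IsAiflSeq (f : Transduction A G D) (u : DataWord A D)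
    (al : List (D × IflType)) : Prop :=
  IsIflSeq f u (al.map Prod.fst) ∧ ∀ p ∈ al, HasIflType f u p.1 p.2

/-- The equivalence `u1 ≡_f u2`. -/
def FEquiv (f : Transduction A G D) (u1 u2 : DataWord A D) : Prop :=
  ∃ π : Equiv.Perm D,
    (∀ v, foShift ((u1.length : ℤ) - (u2.length : ℤ))
        (leftFac f (permW π u2) v) = leftFac f u1 v) ∧
    (∀ al, IsAiflSeq f (permW π u2) al ↔ IsAiflSeq f u1 al) ∧
    (∀ u v1 v2, (rightFac f (u1 ++ u) v1 = rightFac f (u1 ++ u) v2) ↔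
        (rightFac f (permW π u2 ++ u) v1 = rightFac f (permW π u2 ++ u) v2))

/-- `≡_f` has finitely many equivalence classes. -/
def FEquivFiniteIndex (f : Transduction A G D) : Prop :=
  ∃ S : Set (DataWord A D), S.Finite ∧ ∀ u, ∃ r ∈ S, FEquiv f r u

/-- `E` is an equalizing scheme for `f` with associated sequence `δ 1, δ 2, ⋯`
(the value `δ 0` is irrelevant here): for every data word `u`, the `i`-th
`f`-influencing value of `E(u)(u)` is `δ i`. -/
def IsEqualizingSchemeWith (f : Transduction A G D)
    (E : DataWord A D → Equiv.Perm D) (δ : ℕ → D) : Prop :=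
  ∀ (u : DataWord A D) (l : List D), IsIflSeq f (permW (E u) u) l →
    ∀ (i : ℕ) (h : i < l.length), l.get ⟨i, h⟩ = δ (i + 1)

def IsEqualizingScheme (f : Transduction A G D)
    (E : DataWord A D → Equiv.Perm D) : Prop :=
  ∃ δ : ℕ → D, IsEqualizingSchemeWith f E δ

/-- `v1 ≡_f^E v2`. -/
def REquiv (f : Transduction A G D) (E : DataWord A D → Equiv.Perm D)
    (v1 v2 : DataWord A D) : Prop :=
  ∀ u, rightFac f (permW (E u) u) v1 = rightFac f (permW (E u) u) v2

/-- `≡_f^E` has finitely many equivalence classes. -/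
def REquivFiniteIndex (f : Transduction A G D)
    (E : DataWord A D → Equiv.Perm D) : Prop :=
  ∃ S : Set (DataWord A D), S.Finite ∧ ∀ v, ∃ r ∈ S, REquiv f E r v

/-- The blocks of a factored output: the maximal infixes consisting of
retained triples, in order. -/
def triBlocks (l : List (FOElem G D)) : List (List (FOElem G D)) :=
  (l.splitOnP fun e => !e.isTri).filter fun b => !b.isEmpty

/-- Helper for concretizing non-right blocks: walk `f(u̲ ∣ v̲ ∣ w̲)` and
substitute the `i`-th occurrence of the left mark by the `i`-th left block
(taken from `L`) and the `j`-th occurrence of the middle mark by the `j`-th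
middle block (taken from `M`); right marks are turned into separators. -/
def annotateNR (L M : List (List (FOElem G D))) :
    List (FOElem G D) → ℕ → ℕ → List (Option (List (FOElem G D)))
  | [], _, _ => []
  | .left :: rest, i, j => some (L.getD i []) :: annotateNR L M rest (i + 1) j
  | .middle :: rest, i, j => some (M.getD j []) :: annotateNR L M rest i (j + 1)
  | .right :: rest, i, j => none :: annotateNR L M rest i j
  | .tri g d o :: rest, i, j => some [.tri g d o] :: annotateNR L M rest i j

/-- The concretizations of the non-right blocks of `f(u̲ ∣ v̲ ∣ w̲)`, in order:
the concretization of a non-right block is the concatenation of the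
concretizations of the left blocks (taken from `f(u ∣ v·w̲)`) and the middle
blocks (taken from `f(u̲ ∣ v ∣ w̲)`) occurring in it. -/
def concretizedNRBlocks (f : Transduction A G D) (u v w : DataWord A D) :
    List (List (FOElem G D)) :=
  (((annotateNR (triBlocks (rightFac f u (v ++ w))) (triBlocks (threeFac f u v w))
        (allFac f u v w) 0 0).splitOnP fun o => o.isNone).filter
      fun grp => !grp.isEmpty).map fun grp => grp.reduceOption.flatten

/-- `π` tracks influencing values (relative to the sequence `δ`) on `w`:
the `i`-th `f`-influencing value of `w` is `π (δ i)`. -/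
def TracksInfluencing (f : Transduction A G D) (δ : ℕ → D) (π : Equiv.Perm D)
    (w : DataWord A D) : Prop :=
  ∀ l, IsIflSeq f w l → ∀ (i : ℕ) (h : i < l.length), l.get ⟨i, h⟩ = π (δ (i + 1))

end SSRT

namespace SSRT

section Helpers

set_option linter.unusedSectionVars false

variable {A G D : Type}

/-- Collapse with memory of the previously emitted element. -/
def colP [DecidableEq G] [DecidableEq D] :
    Option (FOElem G D) → List (FOElem G D) → List (FOElem G D)
  | _, [] => []
  | s, x :: xs => if s = some x ∧ x.isMark then colP s xs else x :: colP (some x) xs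

/-- Replace triples with origin at most `n` by the left mark. -/
def lcut (n : ℤ) : FOElem G D → FOElem G D
  | .tri g d o => if o ≤ n then .left else .tri g d o
  | e => e

/-- Replace triples with origin greater than `n` by the right mark. -/
def rcut (n : ℤ) : FOElem G D → FOElem G D
  | .tri g d o => if n < o then .right else .tri g d o
  | e => e

def shiftE (z : ℤ) : FOElem G D → FOElem G D
  | .tri g d o => .tri g d (o + z)
  | e => e

def permE (π : Equiv.Perm D) : FOElem G D → FOElem G D
  | .tri g d o => .tri g (π d) o
  | e => e

def toFO (w : OutWord G D) : List (FOElem G D) :=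
  w.map fun t => FOElem.tri t.1 t.2.1 (t.2.2 : ℤ)

theorem foShift_eq (z : ℤ) (l : List (FOElem G D)) : foShift z l = l.map (shiftE z) := by
  unfold foShift
  apply List.map_congr_left
  intro e _
  cases e <;> rfl

theorem permFO_eq (π : Equiv.Perm D) (l : List (FOElem G D)) :
    permFO π l = l.map (permE π) := by
  unfold permFO
  apply List.map_congr_left
  intro e _
  cases e <;> rfl

variable [DecidableEq G] [DecidableEq D]

theorem collapse_cons (x : FOElem G D) (xs : List (FOElem G D)) :
    collapse (x :: xs) = x :: colP (some x) xs := by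
  induction xs generalizing x with
  | nil => simp [collapse, colP]
  | cons y ys ih =>
    rw [collapse, colP]
    by_cases h : x = y ∧ x.isMark = true
    · rw [if_pos h, ih]
      obtain ⟨rfl, h⟩ := h
      simp [h]
    · rw [if_neg h, ih, if_neg]
      rintro ⟨h1, h2⟩
      cases h1
      exact h ⟨rfl, h2⟩

theorem collapse_eq (X : List (FOElem G D)) : collapse X = colP none X := by
  cases X with
  | nil => simp [collapse, colP]
  | cons x xs => rw [collapse_cons, colP]; simp

theorem colP_map (g : FOElem G D → FOElem G D)
    (hg : ∀ e, e.isMark = true → (g e).isMark = true)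
    (X : List (FOElem G D)) (s : Option (FOElem G D)) :
    colP (s.map g) ((colP s X).map g) = colP (s.map g) (X.map g) := by
  induction X generalizing s with
  | nil => simp [colP]
  | cons x xs ih =>
    by_cases h : s = some x ∧ x.isMark = true
    · rw [colP, if_pos h, ih, List.map_cons, colP, if_pos]
      exact ⟨by simp [h.1], hg _ h.2⟩
    · rw [colP, if_neg h, List.map_cons, List.map_cons, colP, colP]
      by_cases h' : s.map g = some (g x) ∧ (g x).isMark = true
      · rw [if_pos h', if_pos h', h'.1]
        exact ih (some x)
      · rw [if_neg h', if_neg h']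
        congr 1
        exact ih (some x)

theorem collapse_map (g : FOElem G D → FOElem G D)
    (hg : ∀ e, e.isMark = true → (g e).isMark = true)
    (X : List (FOElem G D)) :
    collapse ((collapse X).map g) = collapse (X.map g) := by
  simpa [collapse_eq] using colP_map g hg X none

theorem colP_map_inj (g : FOElem G D → FOElem G D) (hi : Function.Injective g)
    (hg : ∀ e, (g e).isMark = e.isMark)
    (X : List (FOElem G D)) (s : Option (FOElem G D)) :
    colP (s.map g) (X.map g) = (colP s X).map g := by
  induction X generalizing s with
  | nil => simp [colP]
  | cons x xs ih =>
    have e : s.map g = some (g x) ↔ s = some x := by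
      cases s <;> simp [hi.eq_iff]
    simp only [List.map_cons, colP, e, hg]
    by_cases h : s = some x ∧ x.isMark = true
    · rw [if_pos h, if_pos h, ih]
    · rw [if_neg h, if_neg h, List.map_cons]
      congr 1
      exact ih (some x)

theorem collapse_map_inj (g : FOElem G D → FOElem G D) (hi : Function.Injective g)
    (hg : ∀ e, (g e).isMark = e.isMark)
    (X : List (FOElem G D)) :
    collapse (X.map g) = (collapse X).map g := by
  simpa [collapse_eq] using colP_map_inj g hi hg X none

theorem lcut_mark (n : ℤ) (e : FOElem G D) (h : e.isMark = true) :
    (lcut n e).isMark = true := by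
  cases e <;> simp_all [lcut, FOElem.isMark, FOElem.isTri]

theorem rcut_mark (n : ℤ) (e : FOElem G D) (h : e.isMark = true) :
    (rcut n e).isMark = true := by
  cases e <;> simp_all [rcut, FOElem.isMark, FOElem.isTri]

theorem shiftE_inj (z : ℤ) : Function.Injective (shiftE z : FOElem G D → FOElem G D) := by
  intro a b h
  cases a <;> cases b <;> simp_all [shiftE]

theorem shiftE_mark (z : ℤ) (e : FOElem G D) : (shiftE z e).isMark = e.isMark := by
  cases e <;> rfl

theorem permE_inj (π : Equiv.Perm D) : Function.Injective (permE π : FOElem G D → FOElem G D) := by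
  intro a b h
  cases a <;> cases b <;> simp_all [permE]

theorem permE_mark (π : Equiv.Perm D) (e : FOElem G D) : (permE π e).isMark = e.isMark := by
  cases e <;> rfl

theorem recon_aux (n : ℤ) : ∀ (k : ℕ) (X Y : List (FOElem G D)) (s : Option (FOElem G D)),
    X.length + Y.length ≤ k →
    (∀ e ∈ X, e ≠ .left ∧ e ≠ .middle) → (∀ e ∈ Y, e ≠ .left ∧ e ≠ .middle) →
    (∀ e, s = some e → e ≠ .left ∧ e ≠ .middle) →
    colP (s.map (lcut n)) (X.map (lcut n)) = colP (s.map (lcut n)) (Y.map (lcut n)) →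
    colP (s.map (rcut n)) (X.map (rcut n)) = colP (s.map (rcut n)) (Y.map (rcut n)) →
    colP s X = colP s Y := by
  intro k
  induction k with
  | zero =>
    intro X Y s hk
    have : X = [] := by cases X <;> simp_all
    have : Y = [] := by cases Y <;> simp_all
    simp_all
  | succ k ih =>
    -- stuttering right marks on the left list may be skipped
    have skip : ∀ (X Y : List (FOElem G D)),
        X.length + 1 + Y.length ≤ k + 1 →
        (∀ e ∈ X, e ≠ .left ∧ e ≠ .middle) → (∀ e ∈ Y, e ≠ .left ∧ e ≠ .middle) →
        colP ((some FOElem.right).map (lcut n)) ((.right :: X).map (lcut n))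
          = colP ((some FOElem.right).map (lcut n)) (Y.map (lcut n)) →
        colP ((some FOElem.right).map (rcut n)) ((.right :: X).map (rcut n))
          = colP ((some FOElem.right).map (rcut n)) (Y.map (rcut n)) →
        colP (some FOElem.right) (.right :: X) = colP (some FOElem.right) Y := by
      intro X Y hk hX hY h1 h2
      have : colP (some FOElem.right) (.right :: X) = colP (some FOElem.right) X := by
        simp [colP, FOElem.isMark, FOElem.isTri]
      rw [this]
      refine ih X Y _ (by omega) hX hY (by simp) ?_ ?_
      · rw [← h1]; simp [colP, lcut, FOElem.isMark, FOElem.isTri]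
      · rw [← h2]; simp [colP, rcut, FOElem.isMark, FOElem.isTri]
    intro X Y s hk hX hY hs h1 h2
    by_cases hsX : s = some .right ∧ ∃ X', X = .right :: X'
    · obtain ⟨rfl, X', rfl⟩ := hsX
      exact skip X' Y (by simpa using hk) (fun e he => hX e (by simp [he])) hY h1 h2
    by_cases hsY : s = some .right ∧ ∃ Y', Y = .right :: Y'
    · obtain ⟨rfl, Y', rfl⟩ := hsY
      exact (skip Y' X (by simp at hk; omega) (fun e he => hY e (by simp [he])) hX
        h1.symm h2.symm).symm
    cases X with
    | nil =>
      cases Y with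
      | nil => rfl
      | cons y Y =>
        exfalso
        have hy := hY y (by simp)
        rcases s with _ | s
        · simp [colP] at h1
        have hs := hs s rfl
        cases s <;> cases y <;>
          simp [colP, lcut, rcut, FOElem.isMark, FOElem.isTri] at h1 h2 hs hy hsY <;> grind
    | cons x X =>
      cases Y with
      | nil =>
        exfalso
        have hx := hX x (by simp)
        rcases s with _ | s
        · simp [colP] at h1
        have hs := hs s rfl
        cases s <;> cases x <;>
          simp [colP, lcut, rcut, FOElem.isMark, FOElem.isTri] at h1 h2 hs hx hsX <;> grind
      | cons y Y =>
        have hx := hX x (by simp)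
        have hy := hY y (by simp)
        have hX' : ∀ e ∈ X, e ≠ .left ∧ e ≠ .middle := fun e he => hX e (by simp [he])
        have hY' : ∀ e ∈ Y, e ≠ .left ∧ e ≠ .middle := fun e he => hY e (by simp [he])
        have hk' : X.length + Y.length ≤ k := by simp at hk; omega
        have key : x = y ∧
            colP ((some x).map (lcut n)) (X.map (lcut n))
              = colP ((some x).map (lcut n)) (Y.map (lcut n)) ∧
            colP ((some x).map (rcut n)) (X.map (rcut n))
              = colP ((some x).map (rcut n)) (Y.map (rcut n)) := by
          rcases s with _ | s
          · clear ih skip hX hY hX' hY' hk hk' hs hsX hsY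
            cases x <;> cases y <;>
              simp [colP, lcut, rcut, FOElem.isMark, FOElem.isTri] at h1 h2 hx hy ⊢ <;> grind
          have hs := hs s rfl
          clear ih skip hX hY hX' hY' hk hk'
          cases s <;> cases x <;> cases y <;>
            simp [colP, lcut, rcut, FOElem.isMark, FOElem.isTri] at h1 h2 hx hy hs hsX hsY ⊢ <;>
              grind
        obtain ⟨rfl, k1, k2⟩ := key
        have := ih X Y (some x) hk' hX' hY' (by rintro e ⟨⟩; exact hx) k1 k2
        rw [colP, colP]
        by_cases h : s = some x ∧ x.isMark = true
        · rw [if_pos h, if_pos h, h.1, this]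
        · rw [if_neg h, if_neg h, this]

theorem recon (n : ℤ) (X Y : List (FOElem G D))
    (hX : ∀ e ∈ X, e ≠ .left ∧ e ≠ .middle) (hY : ∀ e ∈ Y, e ≠ .left ∧ e ≠ .middle)
    (h1 : collapse (X.map (lcut n)) = collapse (Y.map (lcut n)))
    (h2 : collapse (X.map (rcut n)) = collapse (Y.map (rcut n))) :
    collapse X = collapse Y := by
  rw [collapse_eq, collapse_eq] at *
  exact recon_aux n _ X Y none le_rfl hX hY (by simp) h1 h2

theorem leftFac_eq (f : Transduction A G D) (u v : DataWord A D) :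
    leftFac f u v = collapse ((toFO (f (u ++ v))).map (lcut u.length)) := by
  unfold leftFac toFO
  rw [List.map_map]
  congr 1
  apply List.map_congr_left
  intro t _
  simp [lcut]

theorem rightFac_eq (f : Transduction A G D) (u v : DataWord A D) :
    rightFac f u v = collapse ((toFO (f (u ++ v))).map (rcut u.length)) := by
  unfold rightFac toFO
  rw [List.map_map]
  congr 1
  apply List.map_congr_left
  intro t _
  simp [rcut]

theorem leftFac_append (f : Transduction A G D) (u a v : DataWord A D) :
    leftFac f (u ++ a) v = collapse ((leftFac f u (a ++ v)).map (lcut (u ++ a).length)) := by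
  rw [leftFac_eq, leftFac_eq, collapse_map _ (lcut_mark _), List.map_map, List.append_assoc]
  congr 1
  apply List.map_congr_left
  intro e _
  cases e <;> simp [lcut]
  grind [lcut]

theorem rightFac_append (f : Transduction A G D) (u a v : DataWord A D) :
    rightFac f u (a ++ v) = collapse ((rightFac f (u ++ a) v).map (rcut u.length)) := by
  rw [rightFac_eq, rightFac_eq, collapse_map _ (rcut_mark _), List.map_map, List.append_assoc]
  congr 1
  apply List.map_congr_left
  intro e _
  cases e <;> simp [rcut]
  grind [rcut]

theorem three_eq (f : Transduction A G D) (u a v : DataWord A D) :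
    collapse ((leftFac f u (a ++ v)).map (rcut (u ++ a).length))
      = collapse ((rightFac f (u ++ a) v).map (lcut u.length)) := by
  rw [rightFac_eq, leftFac_eq, collapse_map _ (rcut_mark _), collapse_map _ (lcut_mark _),
    List.map_map, List.map_map, List.append_assoc]
  congr 1
  apply List.map_congr_left
  intro e _
  cases e <;> simp [rcut, lcut]
  grind [rcut, lcut]

theorem rightFac_iff (f : Transduction A G D) (u a v1 v2 : DataWord A D) :
    rightFac f (u ++ a) v1 = rightFac f (u ++ a) v2 ↔
      (collapse ((leftFac f u (a ++ v1)).map (rcut (u ++ a).length))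
        = collapse ((leftFac f u (a ++ v2)).map (rcut (u ++ a).length)) ∧
      rightFac f u (a ++ v1) = rightFac f u (a ++ v2)) := by
  constructor
  · intro h
    rw [three_eq, three_eq, rightFac_append, rightFac_append, h]
    exact ⟨rfl, rfl⟩
  · rintro ⟨h1, h2⟩
    rw [three_eq, three_eq] at h1
    rw [rightFac_append f u a v1, rightFac_append f u a v2] at h2
    rw [rightFac_eq, rightFac_eq] at h1 h2 ⊢
    rw [collapse_map _ (lcut_mark _), collapse_map _ (lcut_mark _)] at h1
    rw [collapse_map _ (rcut_mark _), collapse_map _ (rcut_mark _)] at h2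
    refine recon _ _ _ ?_ ?_ h1 h2
    all_goals
      intro e he
      simp only [toFO, List.map_map, List.mem_map, Function.comp] at he
      obtain ⟨t, -, rfl⟩ := he
      simp only [rcut]
      split_ifs <;> simp

/-! Permutations acting on data words. -/

theorem permW_append (π : Equiv.Perm D) (u v : DataWord A D) :
    permW π (u ++ v) = permW π u ++ permW π v := by simp [permW]

theorem permW_length (π : Equiv.Perm D) (u : DataWord A D) :
    (permW π u).length = u.length := by simp [permW]

theorem permW_mul (π ρ : Equiv.Perm D) (u : DataWord A D) :
    permW π (permW ρ u) = permW (π * ρ) u := by simp [permW]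

theorem occ_append (d : D) (u v : DataWord A D) :
    OccursIn d (u ++ v) ↔ OccursIn d u ∨ OccursIn d v := by
  simp only [OccursIn, List.mem_append, or_and_right, exists_or]

theorem permW_congr (π ρ : Equiv.Perm D) (u : DataWord A D)
    (h : ∀ d, OccursIn d u → π d = ρ d) : permW π u = permW ρ u := by
  unfold permW
  apply List.map_congr_left
  intro p hp
  rw [h p.2 ⟨p, hp, rfl⟩]

theorem permW_one (u : DataWord A D) : permW 1 u = u := by simp [permW]

theorem permW_fix (π : Equiv.Perm D) (u : DataWord A D)
    (h : ∀ d, OccursIn d u → π d = d) : permW π u = u := by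
  rw [permW_congr π 1 u (by simpa using h), permW_one]

theorem permW_inv_self (π : Equiv.Perm D) (u : DataWord A D) :
    permW π⁻¹ (permW π u) = u := by
  rw [permW_mul, inv_mul_cancel, permW_one]

theorem permW_self_inv (π : Equiv.Perm D) (u : DataWord A D) :
    permW π (permW π⁻¹ u) = u := by
  rw [permW_mul, mul_inv_cancel, permW_one]

theorem occ_permW (π : Equiv.Perm D) (d : D) (u : DataWord A D) :
    OccursIn d (permW π u) ↔ OccursIn (π⁻¹ d) u := by
  unfold OccursIn permW
  constructor
  · rintro ⟨p, hp, rfl⟩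
    simp only [List.mem_map] at hp
    obtain ⟨q, hq, rfl⟩ := hp
    exact ⟨q, hq, by simp⟩
  · rintro ⟨p, hp, h⟩
    exact ⟨(p.1, π p.2), by simp only [List.mem_map]; exact ⟨p, hp, rfl⟩, by simp [h]⟩

theorem permW_swap_fix (d e : D) (u : DataWord A D) (hd : ¬ OccursIn d u)
    (he : ¬ OccursIn e u) : permW (Equiv.swap d e) u = u := by
  apply permW_fix
  intro x hx
  apply Equiv.swap_apply_of_ne_of_ne <;> rintro rfl <;> contradiction

theorem occ_swap_of_ne (d e x : D) (u : DataWord A D) (h1 : x ≠ d) (h2 : x ≠ e) :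
    OccursIn x (permW (Equiv.swap d e) u) ↔ OccursIn x u := by
  rw [occ_permW, Equiv.swap_inv, Equiv.swap_apply_of_ne_of_ne h1 h2]

theorem exists_fresh [Infinite D] (u : DataWord A D) (L : List D) :
    ∃ x, ¬ OccursIn x u ∧ x ∉ L := by
  obtain ⟨x, hx⟩ := Infinite.exists_notMem_finset (u.map Prod.snd ++ L).toFinset
  simp only [List.toFinset_append, Finset.mem_union, List.mem_toFinset, List.mem_map,
    not_or] at hx
  exact ⟨x, hx.1, hx.2⟩

theorem toFO_permOut (π : Equiv.Perm D) (w : OutWord G D) :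
    toFO (permOut π w) = (toFO w).map (permE π) := by
  simp [toFO, permOut, permE]

theorem leftFac_perm {f : Transduction A G D} (hf : PermInvariant f) (π : Equiv.Perm D)
    (u v : DataWord A D) :
    leftFac f (permW π u) (permW π v) = (leftFac f u v).map (permE π) := by
  rw [leftFac_eq, leftFac_eq, ← permW_append, hf, toFO_permOut, permW_length,
    ← collapse_map_inj _ (permE_inj π) (permE_mark π), List.map_map, List.map_map]
  congr 1
  apply List.map_congr_left
  intro e _
  cases e <;> simp [permE, lcut]
  split_ifs <;> rfl

theorem rightFac_perm {f : Transduction A G D} (hf : PermInvariant f) (π : Equiv.Perm D)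
    (u v : DataWord A D) :
    rightFac f (permW π u) (permW π v) = (rightFac f u v).map (permE π) := by
  rw [rightFac_eq, rightFac_eq, ← permW_append, hf, toFO_permOut, permW_length,
    ← collapse_map_inj _ (permE_inj π) (permE_mark π), List.map_map, List.map_map]
  congr 1
  apply List.map_congr_left
  intro e _
  cases e <;> simp [permE, rcut]
  split_ifs <;> rfl

theorem rightFac_perm_fix {f : Transduction A G D} (hf : PermInvariant f)
    (hp : NoDataPeeking f) (π : Equiv.Perm D) (u v : DataWord A D)
    (h : ∀ d, OccursIn d u → π d = d) :
    rightFac f u (permW π v) = rightFac f u v := by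
  have h1 := rightFac_perm hf π u v
  rw [permW_fix π u h] at h1
  rw [h1, rightFac_eq, ← collapse_map_inj _ (permE_inj π) (permE_mark π), List.map_map]
  congr 1
  apply List.map_congr_left
  intro e he
  simp only [toFO, List.mem_map] at he
  obtain ⟨t, ht, rfl⟩ := he
  simp only [Function.comp, rcut]
  split_ifs with ho
  · rfl
  · obtain ⟨i, a, hi, hio⟩ := hp _ t ht
    have hlt : i < u.length := by omega
    rw [List.getElem?_append_left hlt] at hi
    have := h t.2.1 ⟨_, List.mem_of_getElem? hi, rfl⟩
    simp [permE, this]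

theorem replaceD_fresh (u : DataWord A D) (d d' : D) (h : ¬ OccursIn d' u) :
    replaceD u d d' = permW (Equiv.swap d d') u := by
  unfold replaceD permW
  apply List.map_congr_left
  intro p hp
  have : p.2 ≠ d' := fun h' => h ⟨p, hp, h'⟩
  simp [Equiv.swap_apply_def, this]

theorem replaceD_not_occ (u : DataWord A D) (d d' : D) (h : ¬ OccursIn d u) :
    replaceD u d d' = u := by
  unfold replaceD
  conv_rhs => rw [← List.map_id u]
  apply List.map_congr_left
  intro p hp
  have : p.2 ≠ d := fun h' => h ⟨p, hp, h'⟩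
  simp [this]

theorem replaceD_self (u : DataWord A D) (d : D) : replaceD u d d = u := by
  unfold replaceD
  conv_rhs => rw [← List.map_id u]
  apply List.map_congr_left
  intro p hp
  ext <;> simp
  intro h; exact h.symm

theorem iso_perm (π : Equiv.Perm D) (u : DataWord A D) : Iso (permW π u) u := by
  refine ⟨permW_length _ _, ?_, ?_⟩
  · intro i
    simp only [permW, List.getElem?_map, Option.map_map]
    rfl
  · intro i j
    simp only [permW, List.getElem?_map]
    cases u[i]? <;> cases u[j]? <;> simp

theorem safeRepl_of_fresh (u : DataWord A D) (d d' : D) (h : ¬ OccursIn d' u) :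
    SafeRepl d d' u := by
  unfold SafeRepl
  rw [replaceD_fresh u d d' h]
  exact iso_perm _ _

theorem safeRepl_cases (u : DataWord A D) (d d' : D) (h : SafeRepl d d' u) :
    ¬ OccursIn d u ∨ d = d' ∨ ¬ OccursIn d' u := by
  by_contra hc
  push Not at hc
  obtain ⟨⟨p, hp, rfl⟩, hne, ⟨q, hq, rfl⟩⟩ := hc
  obtain ⟨i, hi⟩ := List.mem_iff_getElem?.1 hp
  obtain ⟨j, hj⟩ := List.mem_iff_getElem?.1 hq
  have := (h.2.2 i j).1 (by simp [replaceD, hi, hj])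
  simp [hi, hj] at this
  exact hne this

theorem mem_iff (f : Transduction A G D) (d : D) (u : DataWord A D) :
    Memorable f d u ↔ ∃ v d', ¬ OccursIn d' u ∧
      leftFac f (permW (Equiv.swap d d') u) v ≠ leftFac f u v := by
  constructor
  · rintro ⟨v, d', hs, h⟩
    rcases safeRepl_cases u d d' hs with h' | rfl | h'
    · exact absurd (by rw [replaceD_not_occ u d d' h']) h
    · exact absurd (by rw [replaceD_self]) h
    · exact ⟨v, d', h', by rwa [← replaceD_fresh u d d' h']⟩
  · rintro ⟨v, d', h', h⟩
    exact ⟨v, d', safeRepl_of_fresh u d d' h', by rwa [replaceD_fresh u d d' h']⟩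

theorem vul_iff (f : Transduction A G D) (d : D) (u : DataWord A D) :
    Vulnerable f d u ↔ ∃ u' v d', ¬ OccursIn d u' ∧ ¬ OccursIn d' (u ++ u' ++ v) ∧
      rightFac f (u ++ u') (permW (Equiv.swap d d') v) ≠ rightFac f (u ++ u') v := by
  constructor
  · rintro ⟨u', v, d', hu, hs, h⟩
    rcases safeRepl_cases _ d d' hs with h' | rfl | h'
    · rw [occ_append, not_or] at h'
      exact absurd (by rw [replaceD_not_occ v d d' h'.2]) h
    · exact absurd (by rw [replaceD_self]) h
    · have h2 := h'
      rw [occ_append, not_or] at h2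
      exact ⟨u', v, d', hu, h', by rwa [← replaceD_fresh v d d' h2.2]⟩
  · rintro ⟨u', v, d', hu, h', h⟩
    have h2 := h'
    rw [occ_append, not_or] at h2
    exact ⟨u', v, d', hu, safeRepl_of_fresh _ d d' h', by rwa [replaceD_fresh v d d' h2.2]⟩

theorem perm_lists_ne {π : Equiv.Perm D} {X Y : List (FOElem G D)} (h : X ≠ Y) :
    X.map (permE π) ≠ Y.map (permE π) := fun h' =>
  h (List.map_injective_iff.2 (permE_inj π) h')

theorem shift_perm (z : ℤ) (π : Equiv.Perm D) (X : List (FOElem G D)) :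
    (X.map (permE π)).map (shiftE z) = (X.map (shiftE z)).map (permE π) := by
  rw [List.map_map, List.map_map]
  apply List.map_congr_left
  intro e _
  cases e <;> rfl

theorem swap_comp (d d' d'' : D) (u : DataWord A D) (hne : d ≠ d')
    (hn : d'' ≠ d) (h1 : ¬ OccursIn d' u) (h2 : ¬ OccursIn d'' u) :
    permW (Equiv.swap d' d'') (permW (Equiv.swap d d') u) = permW (Equiv.swap d d'') u := by
  rw [permW_mul]
  apply permW_congr
  intro x hx
  have a1 : x ≠ d' := by rintro rfl; exact h1 hx
  have a2 : x ≠ d'' := by rintro rfl; exact h2 hx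
  simp only [Equiv.Perm.mul_apply, Equiv.swap_apply_def]
  grind

theorem mem_avoid [Infinite D] {f : Transduction A G D} (hf : PermInvariant f) {d : D}
    {u : DataWord A D} (s : DataWord A D) (h : Memorable f d u) :
    ∃ v d', ¬ OccursIn d' u ∧ ¬ OccursIn d' s ∧
      leftFac f (permW (Equiv.swap d d') u) v ≠ leftFac f u v := by
  obtain ⟨v, d', hd', h⟩ := (mem_iff f d u).1 h
  by_cases hdd : d = d'
  · subst hdd
    exact absurd (by rw [Equiv.swap_self]; exact congrArg (fun x => leftFac f x v) (permW_one u)) h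
  obtain ⟨d'', h1, h2⟩ := exists_fresh (u ++ s) [d, d']
  rw [occ_append, not_or] at h1
  simp only [List.mem_cons, List.not_mem_nil, or_false, not_or] at h2
  refine ⟨permW (Equiv.swap d' d'') v, d'', h1.1, h1.2, ?_⟩
  have := perm_lists_ne (π := Equiv.swap d' d'') h
  rw [← leftFac_perm hf, ← leftFac_perm hf, swap_comp d d' d'' u hdd h2.1 hd' h1.1,
    permW_swap_fix d' d'' u hd' h1.1] at this
  exact this

theorem vul_avoid [Infinite D] {f : Transduction A G D} (hf : PermInvariant f) {d : D}
    {u : DataWord A D} (s : DataWord A D) (h : Vulnerable f d u) :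
    ∃ u' v d', ¬ OccursIn d u' ∧ ¬ OccursIn d' (u ++ u' ++ v) ∧ ¬ OccursIn d' s ∧
      rightFac f (u ++ u') (permW (Equiv.swap d d') v) ≠ rightFac f (u ++ u') v := by
  obtain ⟨u', v, d', hdu, hd', h⟩ := (vul_iff f d u).1 h
  by_cases hdd : d = d'
  · subst hdd
    exact absurd (by
      rw [Equiv.swap_self]; exact congrArg (fun x => rightFac f (u ++ u') x) (permW_one v)) h
  obtain ⟨d'', h1, h2⟩ := exists_fresh (u ++ u' ++ v ++ s) [d, d']
  rw [occ_append, not_or] at h1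
  simp only [List.mem_cons, List.not_mem_nil, or_false, not_or] at h2
  refine ⟨u', v, d'', hdu, h1.1, h1.2, ?_⟩
  have := perm_lists_ne (π := Equiv.swap d' d'') h
  have h3 := h1.1
  rw [occ_append, not_or] at h3 hd'
  rw [← rightFac_perm hf, ← rightFac_perm hf, swap_comp d d' d'' v hdd h2.1 hd'.2 h3.2,
    permW_swap_fix d' d'' _ hd'.1 h3.1, permW_swap_fix d' d'' _ hd'.2 h3.2] at this
  exact this

theorem mem_transfer [Infinite D] {f : Transduction A G D} (hf : PermInvariant f) {d : D}
    {u w : DataWord A D} (z z' : ℤ)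
    (hl : ∀ v, (leftFac f w v).map (shiftE z) = (leftFac f u v).map (shiftE z'))
    (h : Memorable f d u) : Memorable f d w := by
  obtain ⟨v, d', h1, h2, h⟩ := mem_avoid hf w h
  rw [mem_iff]
  refine ⟨v, d', h2, fun heq => h ?_⟩
  set ρ := Equiv.swap d d'
  have key : ∀ y : DataWord A D, leftFac f (permW ρ y) v
      = (leftFac f y (permW ρ⁻¹ v)).map (permE ρ) := by
    intro y
    rw [← leftFac_perm hf, permW_self_inv]
  apply List.map_injective_iff.2 (shiftE_inj z')
  rw [← hl v, ← heq, key, key, shift_perm, shift_perm, hl]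

theorem vul_transfer [Infinite D] {f : Transduction A G D} (hf : PermInvariant f) {d : D}
    {u w : DataWord A D}
    (hr : ∀ u' v1 v2, rightFac f (w ++ u') v1 = rightFac f (w ++ u') v2 →
      rightFac f (u ++ u') v1 = rightFac f (u ++ u') v2)
    (h : Vulnerable f d u) : Vulnerable f d w := by
  obtain ⟨u', v, d', hdu, h1, h2, h⟩ := vul_avoid hf w h
  rw [vul_iff]
  refine ⟨u', v, d', hdu, ?_, fun heq => h (hr _ _ _ heq)⟩
  simp only [occ_append, not_or] at h1 ⊢
  exact ⟨⟨h2, h1.1.2⟩, h1.2⟩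

theorem mem_perm {f : Transduction A G D} (hf : PermInvariant f) (π : Equiv.Perm D) {d : D}
    {u : DataWord A D} (h : Memorable f d u) : Memorable f (π d) (permW π u) := by
  rw [mem_iff] at h ⊢
  obtain ⟨v, d', h1, h⟩ := h
  refine ⟨permW π v, π d', by rw [occ_permW]; simpa using h1, ?_⟩
  have := perm_lists_ne (π := π) h
  rw [← leftFac_perm hf, ← leftFac_perm hf, permW_mul] at this
  rw [permW_mul, ← Equiv.mul_swap_eq_swap_mul]
  exact this

theorem vul_perm {f : Transduction A G D} (hf : PermInvariant f) (π : Equiv.Perm D) {d : D}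
    {u : DataWord A D} (h : Vulnerable f d u) : Vulnerable f (π d) (permW π u) := by
  rw [vul_iff] at h ⊢
  obtain ⟨u', v, d', h1, h2, h⟩ := h
  refine ⟨permW π u', permW π v, π d', by rw [occ_permW]; simpa using h1, ?_, ?_⟩
  · rw [← permW_append, ← permW_append, occ_permW]; simpa using h2
  have := perm_lists_ne (π := π) h
  rw [← rightFac_perm hf, ← rightFac_perm hf, permW_mul] at this
  rw [permW_mul, ← permW_append, ← Equiv.mul_swap_eq_swap_mul]
  exact this

theorem mem_perm_iff {f : Transduction A G D} (hf : PermInvariant f) (π : Equiv.Perm D) (d : D)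
    (u : DataWord A D) : Memorable f (π d) (permW π u) ↔ Memorable f d u := by
  refine ⟨fun h => ?_, mem_perm hf π⟩
  have := mem_perm hf π⁻¹ h
  rw [permW_inv_self] at this
  simpa using this

theorem vul_perm_iff {f : Transduction A G D} (hf : PermInvariant f) (π : Equiv.Perm D) (d : D)
    (u : DataWord A D) : Vulnerable f (π d) (permW π u) ↔ Vulnerable f d u := by
  refine ⟨fun h => ?_, vul_perm hf π⟩
  have := vul_perm hf π⁻¹ h
  rw [permW_inv_self] at this
  simpa using this

theorem ifl_perm_iff {f : Transduction A G D} (hf : PermInvariant f) (π : Equiv.Perm D) (d : D)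
    (u : DataWord A D) : Influencing f (π d) (permW π u) ↔ Influencing f d u := by
  unfold Influencing
  rw [mem_perm_iff hf, vul_perm_iff hf]

/-- Influencing values occur in the word. -/
theorem ifl_occ {f : Transduction A G D} (hf : PermInvariant f)
    (hp : NoDataPeeking f) {d : D} {u : DataWord A D} (h : Influencing f d u) :
    OccursIn d u := by
  by_contra hd
  rcases h with h | h
  · obtain ⟨v, d', h1, h⟩ := (mem_iff f d u).1 h
    exact h (by rw [permW_swap_fix d d' u hd h1])
  · obtain ⟨u', v, d', hdu, hd', h⟩ := (vul_iff f d u).1 h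
    apply h
    apply rightFac_perm_fix hf hp
    rw [occ_append, not_or] at hd'
    intro x hx
    apply Equiv.swap_apply_of_ne_of_ne
    · rintro rfl
      rw [occ_append] at hx
      tauto
    · rintro rfl
      exact hd'.1 hx

/-- Swapping two non-memorable values does not change the left-factored output. -/
theorem leftFac_swap [Infinite D] {f : Transduction A G D} (hf : PermInvariant f) {d e : D}
    {w : DataWord A D} (hd : ¬ Memorable f d w) (he : ¬ Memorable f e w) (v : DataWord A D) :
    leftFac f (permW (Equiv.swap d e) w) v = leftFac f w v := by
  by_cases hde : d = e
  · subst hde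
    rw [Equiv.swap_self]
    exact congrArg (fun x => leftFac f x v) (permW_one w)
  have nm : ∀ (x x' : D) (y : DataWord A D), ¬ Memorable f x y → ¬ OccursIn x' y →
      leftFac f (permW (Equiv.swap x x') y) v = leftFac f y v := by
    intro x x' y hx hx'
    by_contra hc
    exact hx ((mem_iff f x y).2 ⟨v, x', hx', hc⟩)
  obtain ⟨e', h1, h2⟩ := exists_fresh w [d, e]
  obtain ⟨d', h3, h4⟩ := exists_fresh w [d, e, e']
  simp only [List.mem_cons, List.not_mem_nil, or_false, not_or] at h2 h4
  have m : ∀ (π : Equiv.Perm D) (x : D) (y : DataWord A D), ¬ Memorable f (π⁻¹ x) y →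
      ¬ Memorable f x (permW π y) := by
    intro π x y h
    rw [← mem_perm_iff hf π⁻¹, permW_inv_self]
    exact h
  -- the target word after two fresh replacements
  have a1 := nm e e' w he h1
  have a2 := nm d d' (permW (Equiv.swap e e') w)
    (by apply m; rwa [Equiv.swap_inv, Equiv.swap_apply_of_ne_of_ne hde (Ne.symm h2.1)])
    (by rwa [occ_swap_of_ne e e' d' w h4.2.1 h4.2.2])
  set w4 := permW (Equiv.swap d e) w with hw4
  have b0 : ¬ Memorable f e w4 := by
    apply m; rwa [Equiv.swap_inv, Equiv.swap_apply_right]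
  have b1 := nm d e' w4
    (by apply m; rwa [Equiv.swap_inv, Equiv.swap_apply_left])
    (by rwa [hw4, occ_swap_of_ne d e e' w h2.1 h2.2])
  have b2 := nm e d' (permW (Equiv.swap d e') w4)
    (by apply m; rwa [Equiv.swap_inv, Equiv.swap_apply_of_ne_of_ne (Ne.symm hde) (Ne.symm h2.2)])
    (by rwa [occ_swap_of_ne d e' d' w4 h4.1 h4.2.2, hw4, occ_swap_of_ne d e d' w h4.1 h4.2.1])
  have c : permW (Equiv.swap e d') (permW (Equiv.swap d e') w4)
      = permW (Equiv.swap d d') (permW (Equiv.swap e e') w) := by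
    rw [hw4, permW_mul, permW_mul, permW_mul]
    apply permW_congr
    intro x hx
    have x1 : x ≠ d' := by rintro rfl; exact h3 hx
    have x2 : x ≠ e' := by rintro rfl; exact h1 hx
    simp only [Equiv.Perm.mul_apply, Equiv.swap_apply_def]
    grind
  rw [← b1, ← b2, c, a2, a1]

/-- Swapping two non-vulnerable values in the suffix does not change the right-factored output. -/
theorem rightFac_swap [Infinite D] {f : Transduction A G D} {d e : D}
    {w : DataWord A D} (hd : ¬ Vulnerable f d w) (he : ¬ Vulnerable f e w) (v : DataWord A D) :
    rightFac f w (permW (Equiv.swap d e) v) = rightFac f w v := by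
  by_cases hde : d = e
  · subst hde
    rw [Equiv.swap_self]
    exact congrArg (fun x => rightFac f w x) (permW_one v)
  have nm : ∀ (x x' : D) (y : DataWord A D), ¬ Vulnerable f x w → ¬ OccursIn x' w →
      ¬ OccursIn x' y →
      rightFac f w (permW (Equiv.swap x x') y) = rightFac f w y := by
    intro x x' y hx hx' hx''
    by_contra hc
    refine hx ((vul_iff f x w).2 ⟨[], y, x', by simp [OccursIn], ?_, by simpa using hc⟩)
    simp [occ_append, hx', hx'']
  obtain ⟨e', h1, h2⟩ := exists_fresh (w ++ v) [d, e]
  obtain ⟨d', h3, h4⟩ := exists_fresh (w ++ v) [d, e, e']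
  rw [occ_append, not_or] at h1 h3
  simp only [List.mem_cons, List.not_mem_nil, or_false, not_or] at h2 h4
  have a1 := nm e e' v he h1.1 h1.2
  have a2 := nm d d' (permW (Equiv.swap e e') v) hd h3.1
    (by rw [occ_swap_of_ne e e' d' v h4.2.1 h4.2.2]; exact h3.2)
  set v4 := permW (Equiv.swap d e) v with hv4
  have b1 := nm d e' v4 hd h1.1
    (by rw [hv4, occ_swap_of_ne d e e' v h2.1 h2.2]; exact h1.2)
  have b2 := nm e d' (permW (Equiv.swap d e') v4) he h3.1
    (by rw [occ_swap_of_ne d e' d' v4 h4.1 h4.2.2, hv4, occ_swap_of_ne d e d' v h4.1 h4.2.1]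
        exact h3.2)
  have c : permW (Equiv.swap e d') (permW (Equiv.swap d e') v4)
      = permW (Equiv.swap d d') (permW (Equiv.swap e e') v) := by
    rw [hv4, permW_mul, permW_mul, permW_mul]
    apply permW_congr
    intro x hx
    have x1 : x ≠ d' := by rintro rfl; exact h3.2 hx
    have x2 : x ≠ e' := by rintro rfl; exact h1.2 hx
    simp only [Equiv.Perm.mul_apply, Equiv.swap_apply_def]
    grind
  rw [← b1, ← b2, c, a2, a1]

theorem rightFac_swap_iff [Infinite D] {f : Transduction A G D} (hf : PermInvariant f) {d e : D}
    {w : DataWord A D} (hd : ¬ Influencing f d w) (he : ¬ Influencing f e w)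
    (u v1 v2 : DataWord A D) :
    rightFac f (permW (Equiv.swap d e) w ++ u) v1 = rightFac f (permW (Equiv.swap d e) w ++ u) v2
      ↔ rightFac f (w ++ u) v1 = rightFac f (w ++ u) v2 := by
  unfold Influencing at hd he
  rw [not_or] at hd he
  have key : ∀ V, rightFac f (permW (Equiv.swap d e) w) V
      = (rightFac f w V).map (permE (Equiv.swap d e)) := by
    intro V
    rw [← rightFac_swap hd.2 he.2 V, ← rightFac_perm hf, permW_mul, Equiv.swap_mul_self,
      permW_one]
  rw [rightFac_iff, rightFac_iff, leftFac_swap hf hd.1 he.1, leftFac_swap hf hd.1 he.1,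
    key, key, (List.map_injective_iff.2 (permE_inj (Equiv.swap d e))).eq_iff]
  simp only [List.length_append, permW_length]

/-! Order of last occurrences. -/

theorem lastOcc_unique {u : DataWord A D} {d : D} {i j : ℕ} (hi : IsLastOcc u d i)
    (hj : IsLastOcc u d j) : i = j := by
  obtain ⟨⟨a, ha⟩, hi⟩ := hi
  obtain ⟨⟨b, hb⟩, hj⟩ := hj
  rcases lt_trichotomy i j with h | h | h
  · exact absurd rfl (hi j h _ hb)
  · exact h
  · exact absurd rfl (hj i h _ ha)

theorem fresher_asymm {u : DataWord A D} {x y : D} (h : Fresher u x y) : ¬ Fresher u y x := by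
  rintro ⟨i, j, hi, hj, hij⟩
  obtain ⟨i', j', hi', hj', hij'⟩ := h
  have := lastOcc_unique hi hj'
  have := lastOcc_unique hj hi'
  omega

theorem lastOcc_append (u : DataWord A D) (σ : A) (d x : D) (i : ℕ) :
    IsLastOcc (u ++ [(σ, d)]) x i ↔ (x = d ∧ i = u.length) ∨ (x ≠ d ∧ IsLastOcc u x i) := by
  constructor
  · rintro ⟨⟨a, ha⟩, h⟩
    have hlt : i < u.length + 1 := by
      have := (List.getElem?_eq_some_iff.1 ha).1
      simpa using this
    by_cases hi : i = u.length
    · subst hi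
      simp at ha
      exact Or.inl ⟨ha.2.symm, rfl⟩
    · have hi' : i < u.length := by omega
      rw [List.getElem?_append_left hi'] at ha
      refine Or.inr ⟨?_, ⟨a, ha⟩, ?_⟩
      · exact Ne.symm (h u.length hi' (σ, d) (by simp))
      · intro j hj p hp
        have := (List.getElem?_eq_some_iff.1 hp).1
        exact h j hj p (by rw [List.getElem?_append_left this]; exact hp)
  · rintro (⟨rfl, rfl⟩ | ⟨hne, ⟨a, ha⟩, h⟩)
    · refine ⟨⟨σ, by simp⟩, ?_⟩
      intro j hj p hp
      have := (List.getElem?_eq_some_iff.1 hp).1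
      simp at this
      omega
    · have hi := (List.getElem?_eq_some_iff.1 ha).1
      refine ⟨⟨a, by rw [List.getElem?_append_left hi]; exact ha⟩, ?_⟩
      intro j hj p hp
      have hjl := (List.getElem?_eq_some_iff.1 hp).1
      simp at hjl
      by_cases hj' : j = u.length
      · subst hj'
        simp at hp
        subst hp
        exact Ne.symm hne
      · rw [List.getElem?_append_left (by omega)] at hp
        exact h j hj p hp

theorem exists_lastOcc {u : DataWord A D} {x : D} (h : OccursIn x u) :
    ∃ i, IsLastOcc u x i := by
  induction u using List.reverseRecOn with
  | nil => simp [OccursIn] at h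
  | append_singleton u p ih =>
    obtain ⟨σ, d⟩ := p
    by_cases hx : x = d
    · exact ⟨u.length, (lastOcc_append u σ d x _).2 (Or.inl ⟨hx, rfl⟩)⟩
    · rw [occ_append] at h
      rcases h with h | ⟨p, hp, rfl⟩
      · obtain ⟨i, hi⟩ := ih h
        exact ⟨i, (lastOcc_append u σ d x i).2 (Or.inr ⟨hx, hi⟩)⟩
      · simp at hp
        exact absurd (by rw [hp]) hx

theorem lastOcc_lt {u : DataWord A D} {x : D} {i : ℕ} (h : IsLastOcc u x i) : i < u.length := by
  obtain ⟨⟨a, ha⟩, -⟩ := h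
  exact (List.getElem?_eq_some_iff.1 ha).1

theorem fresher_append (u : DataWord A D) (σ : A) (d x y : D) :
    Fresher (u ++ [(σ, d)]) x y ↔
      y ≠ d ∧ ((x = d ∧ ∃ j, IsLastOcc u y j) ∨ (x ≠ d ∧ Fresher u x y)) := by
  unfold Fresher
  simp only [lastOcc_append]
  constructor
  · rintro ⟨i, j, hi, hj, hij⟩
    rcases hj with ⟨rfl, rfl⟩ | ⟨hy, hj⟩
    · rcases hi with ⟨rfl, rfl⟩ | ⟨hx, hi⟩
      · omega
      · have := lastOcc_lt hi
        omega
    · refine ⟨hy, ?_⟩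
      rcases hi with ⟨rfl, rfl⟩ | ⟨hx, hi⟩
      · exact Or.inl ⟨rfl, j, hj⟩
      · exact Or.inr ⟨hx, i, j, hi, hj, hij⟩
  · rintro ⟨hy, ⟨rfl, j, hj⟩ | ⟨hx, i, j, hi, hj, hij⟩⟩
    · exact ⟨u.length, j, Or.inl ⟨rfl, rfl⟩, Or.inr ⟨hy, hj⟩, lastOcc_lt hj⟩
    · exact ⟨i, j, Or.inr ⟨hx, hi⟩, Or.inr ⟨hy, hj⟩, hij⟩

theorem fresher_perm (π : Equiv.Perm D) {u : DataWord A D} {x y : D} (h : Fresher u x y) :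
    Fresher (permW π u) (π x) (π y) := by
  have key : ∀ x i, IsLastOcc u x i → IsLastOcc (permW π u) (π x) i := by
    rintro x i ⟨⟨a, ha⟩, h⟩
    refine ⟨⟨a, by simp [permW, ha]⟩, ?_⟩
    intro j hj p hp
    simp only [permW, List.getElem?_map, Option.map_eq_some_iff] at hp
    obtain ⟨q, hq, rfl⟩ := hp
    have := h j hj q hq
    simpa using this
  obtain ⟨i, j, hi, hj, hij⟩ := h
  exact ⟨i, j, key _ _ hi, key _ _ hj, hij⟩

theorem iflSeq_perm {f : Transduction A G D} (hf : PermInvariant f) (π : Equiv.Perm D)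
    {u : DataWord A D} {l : List D} (h : IsIflSeq f u l) :
    IsIflSeq f (permW π u) (l.map π) := by
  obtain ⟨h1, h2, h3⟩ := h
  refine ⟨?_, h2.map π.injective, ?_⟩
  · intro d
    have : d = π (π⁻¹ d) := by simp
    rw [this, ifl_perm_iff hf, ← h1]
    exact List.mem_map_of_injective π.injective
  · intro i j hi hj hij
    simp only [List.length_map] at hi hj
    simpa using fresher_perm π (h3 i j hi hj hij)

theorem iflSeq_unique {f : Transduction A G D} {u : DataWord A D} {l l' : List D}
    (h : IsIflSeq f u l) (h' : IsIflSeq f u l') : l = l' := by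
  obtain ⟨h1, h2, h3⟩ := h
  obtain ⟨h1', h2', h3'⟩ := h'
  have hp : l.Perm l' := (List.perm_ext_iff_of_nodup h2 h2').2 (fun d => by rw [h1, h1'])
  refine hp.eq_of_pairwise (le := Fresher u) ?_ ?_ ?_
  · intro a b _ _ hab hba
    exact absurd hba (fresher_asymm hab)
  · rw [List.pairwise_iff_get]
    intro i j hij
    exact h3 i j i.2 j.2 hij
  · rw [List.pairwise_iff_get]
    intro i j hij
    exact h3' i j i.2 j.2 hij

theorem ifl_append {f : Transduction A G D} {u : DataWord A D} {σ : A} {d x : D}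
    (hne : x ≠ d) (h : Influencing f x (u ++ [(σ, d)])) : Influencing f x u := by
  rcases h with h | h
  · left
    rw [mem_iff] at h ⊢
    obtain ⟨v, x', hx', h⟩ := h
    rw [occ_append, not_or] at hx'
    refine ⟨[(σ, d)] ++ v, x', hx'.1, fun heq => h ?_⟩
    have hfix : permW (Equiv.swap x x') [(σ, d)] = [(σ, d)] := by
      apply permW_swap_fix
      · simpa [OccursIn] using Ne.symm hne
      · exact hx'.2
    rw [permW_append, hfix, leftFac_append, leftFac_append, heq]
    simp only [List.length_append, permW_length]
  · right
    rw [vul_iff] at h ⊢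
    obtain ⟨u', v, x', h1, h2, h⟩ := h
    refine ⟨[(σ, d)] ++ u', v, x', ?_, by simpa using h2, by simpa using h⟩
    rw [occ_append, not_or]
    exact ⟨by simpa [OccursIn] using Ne.symm hne, h1⟩

theorem fresher_transfer {f : Transduction A G D} {u w : DataWord A D} {l : List D}
    (hu : IsIflSeq f u l) (hw : IsIflSeq f w l) {x y : D} (hx : Influencing f x w)
    (hy : Influencing f y w) (h : Fresher w x y) : Fresher u x y := by
  obtain ⟨i, rfl⟩ := List.mem_iff_get.1 ((hw.1 x).2 hx)
  obtain ⟨j, rfl⟩ := List.mem_iff_get.1 ((hw.1 y).2 hy)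
  rcases lt_trichotomy i j with hij | rfl | hij
  · exact hu.2.2 i j i.2 j.2 hij
  · exact absurd h (fresher_asymm h)
  · exact absurd h (fresher_asymm (hw.2.2 j i j.2 i.2 hij))

theorem aifl_append {f : Transduction A G D} (hf : PermInvariant f) (hp : NoDataPeeking f)
    {u w : DataWord A D} {l : List D}
    (hu : IsIflSeq f u l) (hw : IsIflSeq f w l) (σ : A) (d : D)
    (hm : ∀ x, Memorable f x (w ++ [(σ, d)]) ↔ Memorable f x (u ++ [(σ, d)]))
    (hv : ∀ x, Vulnerable f x (w ++ [(σ, d)]) ↔ Vulnerable f x (u ++ [(σ, d)]))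
    (al : List (D × IflType)) (h : IsAiflSeq f (w ++ [(σ, d)]) al) :
    IsAiflSeq f (u ++ [(σ, d)]) al := by
  obtain ⟨⟨h1, h2, h3⟩, h4⟩ := h
  refine ⟨⟨?_, h2, ?_⟩, ?_⟩
  · intro x
    rw [h1]
    unfold Influencing
    rw [hm, hv]
  · intro i j hi hj hij
    have hF := h3 i j hi hj hij
    have hx := (h1 _).1 (List.get_mem (al.map Prod.fst) ⟨i, hi⟩)
    have hy := (h1 _).1 (List.get_mem (al.map Prod.fst) ⟨j, hj⟩)
    generalize (al.map Prod.fst).get ⟨i, hi⟩ = x at hF hx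
    generalize (al.map Prod.fst).get ⟨j, hj⟩ = y at hF hy
    rw [fresher_append] at hF ⊢
    obtain ⟨hyd, hF⟩ := hF
    have hyw := ifl_append hyd hy
    have hyu : Influencing f y u := (hu.1 y).1 ((hw.1 y).2 hyw)
    refine ⟨hyd, ?_⟩
    rcases hF with ⟨hxd, _⟩ | ⟨hxd, hF⟩
    · exact Or.inl ⟨hxd, exists_lastOcc (ifl_occ hf hp hyu)⟩
    · exact Or.inr ⟨hxd, fresher_transfer hu hw (ifl_append hxd hx) hyw hF⟩
  · intro p hpal
    have := h4 p hpal
    cases ht : p.2 <;> simp only [ht, HasIflType, hm, hv] at this ⊢ <;> exact this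

theorem step [Infinite D] {f : Transduction A G D} (hf : PermInvariant f) (hp : NoDataPeeking f)
    {u w : DataWord A D} {l : List D}
    (hu : IsIflSeq f u l) (hw : IsIflSeq f w l) (σ : A) (d : D)
    (hl : ∀ v, foShift ((u.length : ℤ) - (w.length : ℤ)) (leftFac f w v) = leftFac f u v)
    (hr : ∀ u' v1 v2, (rightFac f (u ++ u') v1 = rightFac f (u ++ u') v2) ↔
        (rightFac f (w ++ u') v1 = rightFac f (w ++ u') v2)) :
    (∀ v, foShift (((u ++ [(σ, d)]).length : ℤ) - ((w ++ [(σ, d)]).length : ℤ))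
        (leftFac f (w ++ [(σ, d)]) v) = leftFac f (u ++ [(σ, d)]) v) ∧
    (∀ al, IsAiflSeq f (w ++ [(σ, d)]) al ↔ IsAiflSeq f (u ++ [(σ, d)]) al) ∧
    (∀ u' v1 v2, (rightFac f (u ++ [(σ, d)] ++ u') v1 = rightFac f (u ++ [(σ, d)] ++ u') v2) ↔
        (rightFac f (w ++ [(σ, d)] ++ u') v1 = rightFac f (w ++ [(σ, d)] ++ u') v2)) := by
  have hl' : ∀ v, foShift (((u ++ [(σ, d)]).length : ℤ) - ((w ++ [(σ, d)]).length : ℤ))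
        (leftFac f (w ++ [(σ, d)]) v) = leftFac f (u ++ [(σ, d)]) v := by
    intro v
    rw [leftFac_append, leftFac_append, ← hl, foShift_eq, foShift_eq,
      ← collapse_map_inj _ (shiftE_inj _) (shiftE_mark _), List.map_map, List.map_map]
    congr 1
    apply List.map_congr_left
    intro e _
    cases e <;> simp [lcut, shiftE]
    split_ifs <;> first | rfl | (exfalso; omega)
  have hr' : ∀ u' v1 v2,
      (rightFac f (u ++ [(σ, d)] ++ u') v1 = rightFac f (u ++ [(σ, d)] ++ u') v2) ↔
        (rightFac f (w ++ [(σ, d)] ++ u') v1 = rightFac f (w ++ [(σ, d)] ++ u') v2) := by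
    intro u' v1 v2
    rw [List.append_assoc, List.append_assoc]
    exact hr _ v1 v2
  have hsh : ∀ X : List (FOElem G D), X.map (shiftE 0) = X := by
    intro X
    conv_rhs => rw [← List.map_id X]
    apply List.map_congr_left
    intro e _
    cases e <;> simp [shiftE]
  have hm : ∀ x, Memorable f x (w ++ [(σ, d)]) ↔ Memorable f x (u ++ [(σ, d)]) := by
    intro x
    constructor
    · refine mem_transfer hf 0
        (((u ++ [(σ, d)]).length : ℤ) - ((w ++ [(σ, d)]).length : ℤ)) (fun v => ?_)
      rw [← hl', foShift_eq, hsh]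
    · refine mem_transfer hf
        (((u ++ [(σ, d)]).length : ℤ) - ((w ++ [(σ, d)]).length : ℤ)) 0 (fun v => ?_)
      rw [← hl', foShift_eq, hsh]
  have hv : ∀ x, Vulnerable f x (w ++ [(σ, d)]) ↔ Vulnerable f x (u ++ [(σ, d)]) := by
    intro x
    exact ⟨vul_transfer hf fun u' v1 v2 => (hr' u' v1 v2).1,
      vul_transfer hf fun u' v1 v2 => (hr' u' v1 v2).2⟩
  refine ⟨hl', fun al => ⟨?_, ?_⟩, hr'⟩
  · exact aifl_append hf hp hu hw σ d hm hv al
  · exact aifl_append hf hp hw hu σ d (fun x => (hm x).symm) (fun x => (hv x).symm) al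

theorem exists_aifl (f : Transduction A G D) {u : DataWord A D} {l : List D}
    (h : IsIflSeq f u l) : ∃ al, IsAiflSeq f u al ∧ al.map Prod.fst = l := by
  have : ∀ d ∈ l, ∃ t, HasIflType f u d t := by
    intro d hd
    have := (h.1 d).1 hd
    unfold Influencing at this
    by_cases h1 : Memorable f d u <;> by_cases h2 : Vulnerable f d u
    · exact ⟨.vm, h1, h2⟩
    · exact ⟨.m, h1, h2⟩
    · exact ⟨.v, h2, h1⟩
    · tauto
  have key : ∃ al : List (D × IflType), al.map Prod.fst = l ∧
      ∀ p ∈ al, HasIflType f u p.1 p.2 := by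
    clear h
    induction l with
    | nil => exact ⟨[], by simp⟩
    | cons d l ih =>
      obtain ⟨al, h1, h2⟩ := ih (fun d hd => this d (by simp [hd]))
      obtain ⟨t, ht⟩ := this d (by simp)
      refine ⟨(d, t) :: al, by simp [h1], ?_⟩
      intro p hp
      rcases List.mem_cons.1 hp with rfl | hp
      · exact ht
      · exact h2 p hp
  obtain ⟨al, h1, h2⟩ := key
  exact ⟨al, ⟨by rwa [h1], h2⟩, h1⟩

end Helpers

end SSRT

open SSRT

/-- Lemma 9, point 2. -/
theorem rightCongruences_fEqPreserved
    {D A G : Type} [DecidableEq D] [Infinite D] [DecidableEq G]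
    [Fintype A] [Fintype G]
    (f : Transduction A G D)
    (hperm : PermInvariant f) (hpeek : NoDataPeeking f)
    (u1 u2 : DataWord A D) (hequiv : FEquiv f u1 u2)
    (m : ℕ) (d1 d2 : ℕ → D)
    (hifl1 : IsIflSeq f u1 ((List.range m).map fun k => d1 (k + 1)))
    (hifl2 : IsIflSeq f u2 ((List.range m).map fun k => d2 (k + 1)))
    (hd10 : ¬ Influencing f (d1 0) u1)
    (hd20 : ¬ Influencing f (d2 0) u2)
    (σ : A) :
    ∀ j : ℕ, j ≤ m →
      FEquiv f (u1 ++ [(σ, d1 j)]) (u2 ++ [(σ, d2 j)]) := by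

  obtain ⟨π, hl, ha, hr⟩ := hequiv
  obtain ⟨al, hal, hmap⟩ := exists_aifl f hifl1
  set l1 := (List.range m).map fun k => d1 (k + 1) with hl1
  have hw : IsIflSeq f (permW π u2) l1 := by
    have := ((ha al).2 hal).1
    rwa [hmap] at this
  have hperm2 := iflSeq_perm hperm π hifl2
  have hlists := iflSeq_unique hperm2 hw
  have hlen : (permW π u2).length = u2.length := permW_length π u2
  intro j hj
  -- a suitable permutation suffices
  suffices H : ∃ π' : Equiv.Perm D, π' (d2 j) = d1 j ∧ IsIflSeq f (permW π' u2) l1 ∧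
      (∀ v, leftFac f (permW π' u2) v = leftFac f (permW π u2) v) ∧
      (∀ u v1 v2, (rightFac f (permW π' u2 ++ u) v1 = rightFac f (permW π' u2 ++ u) v2) ↔
        (rightFac f (permW π u2 ++ u) v1 = rightFac f (permW π u2 ++ u) v2)) by
    obtain ⟨π', hd, hi, hl', hr'⟩ := H
    have e : permW π' (u2 ++ [(σ, d2 j)]) = permW π' u2 ++ [(σ, d1 j)] := by
      rw [permW_append]
      simp [permW, hd]
    have := step hperm hpeek hifl1 hi σ (d1 j)
      (fun v => by rw [hl', permW_length]; exact hl v)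
      (fun u v1 v2 => by rw [hr', hr])
    refine ⟨π', ?_⟩
    rw [e]
    refine ⟨?_, this.2⟩
    intro v
    have h1 := this.1 v
    simp only [List.length_append, permW_length, List.length_cons, List.length_nil] at h1 ⊢
    exact h1
  rcases Nat.eq_zero_or_pos j with rfl | hpos
  · have hd : ¬ Influencing f (d1 0) (permW π u2) := by
      rw [← hw.1, hifl1.1]; exact hd10
    have he : ¬ Influencing f (π (d2 0)) (permW π u2) := by
      rw [ifl_perm_iff hperm]; exact hd20
    refine ⟨Equiv.swap (d1 0) (π (d2 0)) * π, by simp, ?_, ?_, ?_⟩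
    · have h1 := iflSeq_perm hperm (Equiv.swap (d1 0) (π (d2 0))) hw
      have h2 : l1.map (Equiv.swap (d1 0) (π (d2 0))) = l1 := by
        conv_rhs => rw [← List.map_id l1]
        apply List.map_congr_left
        intro x hx
        apply Equiv.swap_apply_of_ne_of_ne
        · rintro rfl; exact hd ((hw.1 _).1 hx)
        · rintro rfl; exact he ((hw.1 _).1 hx)
      rw [h2, permW_mul] at h1
      exact h1
    · intro v
      rw [← permW_mul]
      exact leftFac_swap hperm (fun h => hd (Or.inl h)) (fun h => he (Or.inl h)) v
    · intro u v1 v2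
      rw [← permW_mul]
      exact rightFac_swap_iff hperm hd he u v1 v2
  · refine ⟨π, ?_, hw, fun v => rfl, fun u v1 v2 => Iff.rfl⟩
    have hk : j - 1 < m := by omega
    have := congrArg (fun l : List D => l[j - 1]?) hlists
    simp [hl1, hk] at this
    rwa [Nat.sub_add_cancel hpos] at this
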